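/- For every t > 1, the permutation (t+1), t, (t-1), ..., 3, 2, (t+2), 1 of length t+2 is not sortable by the right-greedy algorithm on t stacks in series, but is sortable by the left-greedy algorithm on 2 stacks in series (hence on t stacks). -/

import Mathlib

/-- A configuration for sorting with `t` stacks in series: the remaining input,
the stacks (index `0` is the leftmost, next to the output; index `t-1` is the
rightmost, next to the input; the head of each list is the top of the stack),
and the output produced so far. -/
structure Conf where
  input : List ℕ
  stks : List (List ℕ)
  output : List ℕ
deriving DecidableEq, Repr

/-- `x` may be placed on top of a stack iff the stack is empty or `x` is smaller
than the current top (stacks are increasing from top to bottom). -/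
def canPush (x : ℕ) : List ℕ → Bool
  | [] => true
  | y :: _ => decide (x < y)

/-- Moves, ordered left to right: `0` = pop the leftmost stack to the output
(legal only for the next element of the identity); `m` with `0 < m < t` = move the
top of stack `m` one stack to the left; `t` = push the next input element onto the
rightmost stack. -/
def legal (t : ℕ) (c : Conf) (m : ℕ) : Bool :=
  if m = 0 then
    match c.stks.getD 0 [] with
    | x :: _ => x == c.output.length + 1
    | [] => false
  else if m < t then
    match c.stks.getD m [] with
    | x :: _ => canPush x (c.stks.getD (m-1) [])
    | [] => false
  else if m = t then
    match c.input with
    | x :: _ => canPush x (c.stks.getD (t-1) [])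
    | [] => false
  else false

/-- Perform move `m` on configuration `c` (with `t` stacks). -/
def applyMove (t : ℕ) (c : Conf) (m : ℕ) : Conf :=
  if m = 0 then
    match c.stks.getD 0 [] with
    | x :: s => ⟨c.input, c.stks.set 0 s, c.output ++ [x]⟩
    | [] => c
  else if m < t then
    match c.stks.getD m [] with
    | x :: s => ⟨c.input, (c.stks.set m s).set (m-1) (x :: c.stks.getD (m-1) []), c.output⟩
    | [] => c
  else
    match c.input with
    | x :: rest => ⟨rest, c.stks.set (t-1) (x :: c.stks.getD (t-1) []), c.output⟩
    | [] => c

def initConf (t : ℕ) (p : List ℕ) : Conf := ⟨p, List.replicate t [], []⟩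

/-- The fully sorted configuration: empty input and stacks, output `1,2,...,n`. -/
def finalConf (t n : ℕ) : Conf := ⟨[], List.replicate t [], List.range' 1 n⟩

/-- Run a sequence of moves, requiring each to be legal. -/
def runLegal (t : ℕ) : Conf → List ℕ → Option Conf
  | c, [] => some c
  | c, m :: ms => if legal t c m then runLegal t (applyMove t c m) ms else none

/-- `p` is sortable by `t` stacks in series by some sequence of legal moves. -/
def Sortable (t : ℕ) (p : List ℕ) : Prop :=
  ∃ ms : List ℕ, runLegal t (initConf t p) ms = some (finalConf t p.length)

/-- The leftmost legal move, if any. -/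
def leftMove (t : ℕ) (c : Conf) : Option ℕ :=
  ((List.range (t+1)).filter (fun m => legal t c m)).head?

/-- The rightmost legal move, if any. -/
def rightMove (t : ℕ) (c : Conf) : Option ℕ :=
  ((List.range (t+1)).filter (fun m => legal t c m)).getLast?

/-- One step of a greedy algorithm given by the move selector `mv`
(the configuration is unchanged if no move is legal, i.e. the algorithm fails or is done). -/
def greedyStep (mv : ℕ → Conf → Option ℕ) (t : ℕ) (c : Conf) : Conf :=
  match mv t c with
  | some m => applyMove t c m
  | none => c

/-- The greedy algorithm given by `mv` sorts `p` with `t` stacks in series. -/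
def GreedySorts (mv : ℕ → Conf → Option ℕ) (t : ℕ) (p : List ℕ) : Prop :=
  ∃ k : ℕ, (greedyStep mv t)^[k] (initConf t p) = finalConf t p.length

def LeftGreedySorts : ℕ → List ℕ → Prop := GreedySorts leftMove
def RightGreedySorts : ℕ → List ℕ → Prop := GreedySorts rightMove

/-- `p` is a permutation of `1,...,n` (as a list). -/
def IsPermOf (n : ℕ) (p : List ℕ) : Prop := p.Perm (List.range' 1 n)

/-- The position of the element `x` in configuration `c`: `0` if in the output
(furthest left), `j+1` if in stack `j`, `t+1` if still in the input (furthest right). -/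
def posOf (t : ℕ) (c : Conf) (x : ℕ) : ℕ :=
  if x ∈ c.output then 0
  else match (List.range t).find? (fun j => decide (x ∈ c.stks.getD j [])) with
    | some j => j + 1
    | none => t + 1

/-- `c` is at the `i`-th critical moment for the greedy algorithm `mv` on a
permutation of length `n`: either the chosen move is the entry of the `i`-th
element into the stacks, or the algorithm fails (no legal move, incomplete output). -/
def IsCrit (mv : ℕ → Conf → Option ℕ) (t i n : ℕ) (c : Conf) : Prop :=
  (c.input.length + i = n + 1 ∧ mv t c = some t) ∨
  (mv t c = none ∧ c.output.length < n)

/-- `c` is the configuration at the `i`-th critical moment of the greedy algorithm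
`mv` run on `p` (the first moment along the run satisfying `IsCrit`). -/
def CritConf (mv : ℕ → Conf → Option ℕ) (t i n : ℕ) (p : List ℕ) (c : Conf) : Prop :=
  ∃ k : ℕ, (greedyStep mv t)^[k] (initConf t p) = c ∧ IsCrit mv t i n c ∧
    ∀ k' < k, ¬ IsCrit mv t i n ((greedyStep mv t)^[k'] (initConf t p))

/-- No stack is empty while some stack to its right is nonempty. -/
def NoGap (t : ℕ) (c : Conf) : Prop :=
  ∀ j j' : ℕ, j < j' → j' < t → c.stks.getD j' [] ≠ [] → c.stks.getD j [] ≠ []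

/-- `r` contains `q` as a pattern. -/
def ContainsPat (r q : List ℕ) : Prop :=
  ∃ f : Fin q.length → Fin r.length, StrictMono f ∧
    ∀ a b : Fin q.length, q.get a < q.get b ↔ r.get (f a) < r.get (f b)

/-- The list of the `T` stacks `f 0, ..., f (T - 1)`. -/
def stacksOf (T : ℕ) (f : ℕ → List ℕ) : List (List ℕ) := (List.range T).map f

lemma stacksOf_getD {T m : ℕ} (f : ℕ → List ℕ) (hm : m < T) : (stacksOf T f).getD m [] = f m := by
  simp [stacksOf, List.getD_eq_getElem?_getD, hm]

lemma stacksOf_set (T m : ℕ) (f : ℕ → List ℕ) (s : List ℕ) :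
    (stacksOf T f).set m s = stacksOf T (Function.update f m s) := by
  apply List.ext_getElem
  · simp [stacksOf]
  · intro i h₁ h₂
    simp [stacksOf, List.getElem_set, Function.update_apply, eq_comm]

lemma stacksOf_congr {T : ℕ} {f g : ℕ → List ℕ} (h : ∀ i < T, f i = g i) :
    stacksOf T f = stacksOf T g := by
  simpa [stacksOf] using h

lemma stacksOf_nil (T : ℕ) : stacksOf T (fun _ => []) = List.replicate T [] := by
  simp [stacksOf]

section Moves

variable {T : ℕ} {f : ℕ → List ℕ} {inp out : List ℕ}

lemma legal_zero_iff (hT : 0 < T) :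
    legal T ⟨inp, stacksOf T f, out⟩ 0 = true ↔ ∃ s, f 0 = (out.length + 1) :: s := by
  simp only [legal, if_true, stacksOf_getD f hT]
  cases f 0 <;> simp

lemma legal_middle_iff {m : ℕ} (hm : 0 < m) (hmT : m < T) :
    legal T ⟨inp, stacksOf T f, out⟩ m = true ↔
      ∃ x s, f m = x :: s ∧ canPush x (f (m - 1)) = true := by
  simp only [legal, hm.ne', hmT, if_true, if_false, stacksOf_getD f hmT,
    stacksOf_getD f (show m - 1 < T by omega)]
  cases f m <;> simp

lemma legal_last_iff (hT : 0 < T) :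
    legal T ⟨inp, stacksOf T f, out⟩ T = true ↔
      ∃ x r, inp = x :: r ∧ canPush x (f (T - 1)) = true := by
  simp only [legal, hT.ne', lt_irrefl, if_true, if_false,
    stacksOf_getD f (show T - 1 < T by omega)]
  cases inp <;> simp

lemma applyMove_zero (hT : 0 < T) {x : ℕ} {s : List ℕ} (h : f 0 = x :: s) :
    applyMove T ⟨inp, stacksOf T f, out⟩ 0 =
      ⟨inp, stacksOf T (Function.update f 0 s), out ++ [x]⟩ := by
  simp only [applyMove, if_true, stacksOf_getD f hT, h, stacksOf_set]

lemma applyMove_middle {m : ℕ} (hm : 0 < m) (hmT : m < T) {x : ℕ} {s : List ℕ}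
    (h : f m = x :: s) :
    applyMove T ⟨inp, stacksOf T f, out⟩ m =
      ⟨inp, stacksOf T (Function.update (Function.update f m s) (m - 1) (x :: f (m - 1))),
        out⟩ := by
  simp only [applyMove, hm.ne', hmT, if_true, if_false, stacksOf_getD f hmT,
    stacksOf_getD f (show m - 1 < T by omega), h, stacksOf_set]

lemma applyMove_last (hT : 0 < T) {x : ℕ} {r : List ℕ} :
    applyMove T ⟨x :: r, stacksOf T f, out⟩ T =
      ⟨r, stacksOf T (Function.update f (T - 1) (x :: f (T - 1))), out⟩ := by
  simp only [applyMove, hT.ne', lt_irrefl, if_false,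
    stacksOf_getD f (show T - 1 < T by omega), stacksOf_set]

end Moves

lemma leftMove_eq_some {T m : ℕ} {c : Conf} (hm : m ≤ T) (h : legal T c m = true)
    (hlt : ∀ i < m, ¬ legal T c i = true) : leftMove T c = some m := by
  rw [leftMove, List.head?_filter, List.find?_range_eq_some]
  grind

lemma rightMove_eq_last {T : ℕ} {c : Conf} (h : legal T c T = true) :
    rightMove T c = some T := by
  simp [rightMove, List.range_succ, h]

lemma rightMove_legal {T m : ℕ} {c : Conf} (h : rightMove T c = some m) :
    m ≤ T ∧ legal T c m = true := by
  have := List.mem_of_getLast? h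
  grind

/-- A run of left-greedy on `T` stacks leads from `c` to `d`. -/
def LeftReaches (T : ℕ) (c d : Conf) : Prop := ∃ k : ℕ, (greedyStep leftMove T)^[k] c = d

lemma LeftReaches.refl (T : ℕ) (c : Conf) : LeftReaches T c c := ⟨0, rfl⟩

lemma LeftReaches.trans {T : ℕ} {c d e : Conf} (h₁ : LeftReaches T c d)
    (h₂ : LeftReaches T d e) : LeftReaches T c e := by
  obtain ⟨k, rfl⟩ := h₁
  obtain ⟨l, rfl⟩ := h₂
  exact ⟨l + k, Function.iterate_add_apply _ _ _ _⟩

lemma LeftReaches.of_move {T m : ℕ} {c : Conf} (hm : m ≤ T) (h : legal T c m = true)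
    (hlt : ∀ i < m, ¬ legal T c i = true) : LeftReaches T c (applyMove T c m) :=
  ⟨1, by simp [greedyStep, leftMove_eq_some hm h hlt]⟩

lemma leftReaches_travel {T : ℕ} {g : ℕ → List ℕ} {inp out : List ℕ} {x lo : ℕ} (d : ℕ)
    (hT : lo + d < T) (hill : ∀ i < lo + d, ¬ legal T ⟨inp, stacksOf T g, out⟩ i = true)
    (hpush : ∀ j, lo ≤ j → j < lo + d → canPush x (g j) = true) :
    LeftReaches T ⟨inp, stacksOf T (Function.update g (lo + d) (x :: g (lo + d))), out⟩
      ⟨inp, stacksOf T (Function.update g lo (x :: g lo)), out⟩ := by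
  induction d with
  | zero => exact LeftReaches.refl _ _
  | succ d ih =>
    refine LeftReaches.trans ?_ (ih (by omega) (fun i hi => hill i (by omega))
      (fun j h₁ h₂ => hpush j h₁ (by omega)))
    have hmove := LeftReaches.of_move (T := T) (m := lo + (d + 1))
      (c := ⟨inp, stacksOf T (Function.update g (lo + (d + 1)) (x :: g (lo + (d + 1)))), out⟩)
      hT.le ?_ ?_
    · rw [applyMove_middle (by omega) hT (Function.update_self _ _ _)] at hmove
      convert hmove using 3
      funext i
      simp only [Function.update_apply]
      grind
    · rw [legal_middle_iff (by omega) hT]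
      refine ⟨x, _, Function.update_self _ _ _, ?_⟩
      rw [Function.update_of_ne (by omega)]
      exact hpush _ (by omega) (by omega)
    · intro i hi
      have := hill i hi
      rcases Nat.eq_zero_or_pos i with rfl | hi0
      · rw [legal_zero_iff (by omega)] at this ⊢
        rwa [Function.update_of_ne (by omega)]
      · rw [legal_middle_iff hi0 (by omega)] at this ⊢
        rwa [Function.update_of_ne (by omega), Function.update_of_ne (by omega)]

lemma leftReaches_insert {T : ℕ} {g : ℕ → List ℕ} {inp out : List ℕ} {x : ℕ} (lo : ℕ)
    (hlo : lo < T) (hill : ∀ i < T, ¬ legal T ⟨x :: inp, stacksOf T g, out⟩ i = true)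
    (hpush : ∀ j, lo ≤ j → j < T → canPush x (g j) = true) :
    LeftReaches T ⟨x :: inp, stacksOf T g, out⟩
      ⟨inp, stacksOf T (Function.update g lo (x :: g lo)), out⟩ := by
  have hT : 0 < T := by omega
  have hmove := LeftReaches.of_move le_rfl
    ((legal_last_iff (out := out) hT).2 ⟨x, inp, rfl, hpush (T - 1) (by omega) (by omega)⟩) hill
  rw [applyMove_last hT] at hmove
  refine hmove.trans ?_
  have := leftReaches_travel (T := T) (g := g) (inp := inp) (out := out) (x := x) (lo := lo)
    (T - 1 - lo) (by omega) ?_ (fun j h₁ h₂ => hpush j h₁ (by omega))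
  · rwa [show lo + (T - 1 - lo) = T - 1 by omega] at this
  · intro i hi
    have := hill i (by omega)
    rcases Nat.eq_zero_or_pos i with rfl | hi0
    · rwa [legal_zero_iff hT] at this ⊢
    · rwa [legal_middle_iff hi0 (by omega)] at this ⊢

/-- Stack `0` is `A`, stack `1` is `B`, and all other stacks are empty. -/
def twoStacks (A B : List ℕ) : ℕ → List ℕ
  | 0 => A
  | 1 => B
  | _ + 2 => []

lemma update_twoStacks_zero (A B A' : List ℕ) :
    Function.update (twoStacks A B) 0 A' = twoStacks A' B := by
  funext i
  rcases i with _ | _ | i <;> simp [twoStacks]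

lemma update_twoStacks_one (A B B' : List ℕ) :
    Function.update (twoStacks A B) 1 B' = twoStacks A B' := by
  funext i
  rcases i with _ | _ | i <;> simp [twoStacks]

lemma stacksOf_twoStacks_nil (T : ℕ) : stacksOf T (twoStacks [] []) = List.replicate T [] := by
  rw [← stacksOf_nil]
  refine stacksOf_congr fun i _ => ?_
  rcases i with _ | _ | i <;> rfl

lemma not_legal_twoStacks {T : ℕ} {A B inp out : List ℕ}
    (hA : ∀ s, A ≠ (out.length + 1) :: s)
    (hB : ∀ x s, B = x :: s → ¬ canPush x A = true) :
    ∀ i < T, ¬ legal T ⟨inp, stacksOf T (twoStacks A B), out⟩ i = true := by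
  intro i hi
  rcases i with _ | _ | i
  · rw [legal_zero_iff hi]
    rintro ⟨s, hs⟩
    exact hA s hs
  · rw [legal_middle_iff (by omega) hi]
    rintro ⟨x, s, hs, hx⟩
    exact hB x s hs hx
  · rw [legal_middle_iff (by omega) hi]
    rintro ⟨x, s, hs, -⟩
    simp [twoStacks] at hs

lemma leftReaches_load {T : ℕ} (hT : 1 < T) (r : List ℕ) (k m : ℕ) :
    LeftReaches T
      ⟨(List.range' 2 k).reverse ++ r, stacksOf T (twoStacks (List.range' (2 + k) m) []), []⟩
      ⟨r, stacksOf T (twoStacks (List.range' 2 (k + m)) []), []⟩ := by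
  induction k generalizing m with
  | zero => simpa using LeftReaches.refl _ _
  | succ k ih =>
    have hrun := ih (m + 1)
    rw [List.range'_succ, show 2 + k + 1 = 2 + (k + 1) by ring,
      show k + (m + 1) = k + 1 + m by ring] at hrun
    refine LeftReaches.trans ?_ hrun
    have hins := leftReaches_insert (T := T) (x := 2 + k) (inp := (List.range' 2 k).reverse ++ r)
      (out := []) (g := twoStacks (List.range' (2 + (k + 1)) m) []) 0 (by omega)
      (not_legal_twoStacks ?_ (by simp)) ?_
    · rw [update_twoStacks_zero] at hins
      simpa [List.range'_concat, twoStacks] using hins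
    · cases m <;> simp [List.range'_succ]; omega
    · intro j _ _
      rcases j with _ | _ | j
      · cases m <;> simp [twoStacks, canPush, List.range'_succ]
      · rfl
      · rfl

lemma leftReaches_unload {T : ℕ} (hT : 0 < T) (inp B out : List ℕ) (n : ℕ) :
    LeftReaches T
      ⟨inp, stacksOf T (twoStacks (List.range' (out.length + 1) n) B), out⟩
      ⟨inp, stacksOf T (twoStacks [] B), out ++ List.range' (out.length + 1) n⟩ := by
  induction n generalizing out with
  | zero => simpa using LeftReaches.refl _ _
  | succ n ih =>
    have hrun := ih (out ++ [out.length + 1])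
    have hmove := LeftReaches.of_move (T := T) (m := 0)
      (c := ⟨inp, stacksOf T (twoStacks (List.range' (out.length + 1) (n + 1)) B), out⟩)
      (by omega) ((legal_zero_iff hT).2 ⟨_, List.range'_succ⟩) (by simp)
    have hhead : twoStacks (List.range' (out.length + 1) (n + 1)) B 0 =
        (out.length + 1) :: List.range' (out.length + 1 + 1) n := List.range'_succ
    rw [applyMove_zero hT hhead, update_twoStacks_zero] at hmove
    refine hmove.trans ?_
    simpa [List.range'_succ] using hrun

lemma leftGreedySorts_of_one_lt {T t : ℕ} (hT : 1 < T) (ht : 0 < t) :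
    LeftGreedySorts T ((List.range' 2 t).reverse ++ [t + 2, 1]) := by
  change LeftReaches T (initConf T _) _
  have hload := leftReaches_load hT [t + 2, 1] t 0
  simp only [List.range'_zero, stacksOf_twoStacks_nil, add_zero] at hload
  refine LeftReaches.trans hload ?_
  have hbig := leftReaches_insert (T := T) (x := t + 2) (inp := [1]) (out := [])
    (g := twoStacks (List.range' 2 t) []) 1 hT
    (not_legal_twoStacks (by cases t <;> simp [List.range'_succ]) (by simp))
    (by
      intro j _ _
      rcases j with _ | _ | j
      · omega
      · rfl
      · rfl)
  rw [update_twoStacks_one] at hbig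
  refine LeftReaches.trans hbig ?_
  have hone := leftReaches_insert (T := T) (x := 1) (inp := []) (out := [])
    (g := twoStacks (List.range' 2 t) [t + 2]) 0 (by omega)
    (not_legal_twoStacks (by cases t <;> simp [List.range'_succ])
      (by
        obtain ⟨t, rfl⟩ := Nat.exists_eq_add_of_lt ht
        simp [List.range'_succ, canPush]
        omega))
    (by
      intro j _ _
      rcases j with _ | _ | j
      · cases t <;> simp [twoStacks, canPush, List.range'_succ]
      · simp [twoStacks, canPush]
      · rfl)
  rw [update_twoStacks_zero] at hone
  refine LeftReaches.trans hone ?_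
  refine LeftReaches.trans (leftReaches_unload (by omega) [] [t + 2] [] (t + 1)) ?_
  have hlast := leftReaches_travel (T := T) (x := t + 2) (inp := []) (lo := 0)
    (out := List.range' 1 (t + 1)) (g := twoStacks [] []) 1 (by omega)
    (fun i hi => not_legal_twoStacks (by simp) (by simp) i (by omega))
    (by
      intro j _ hj
      obtain rfl : j = 0 := by omega
      rfl)
  rw [update_twoStacks_zero, zero_add, update_twoStacks_one] at hlast
  refine LeftReaches.trans hlast ?_
  have hunload := leftReaches_unload (T := T) (by omega) [] [] (List.range' 1 (t + 1)) 1
  simpa [twoStacks, finalConf, stacksOf_twoStacks_nil, List.range'_concat, Nat.add_comm 1]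
    using hunload

/-- All of `2, ..., t + 1` are in the stacks, sorted from left to right, with
the elements of stack `i` at most `i + 2`; the remaining input is `t + 2, 1`. -/
def Blocked (t : ℕ) (c : Conf) : Prop :=
  ∃ f : ℕ → List ℕ, c = ⟨[t + 2, 1], stacksOf t f, []⟩ ∧
    (∀ x, 2 ≤ x → x ≤ t + 1 → ∃ i < t, x ∈ f i) ∧
    (∀ i, ∀ x ∈ f i, 2 ≤ x ∧ x ≤ i + 2) ∧
    (∀ i j, i < j → ∀ x ∈ f i, ∀ y ∈ f j, x < y) ∧
    ∀ i, (f i).Pairwise (· < ·)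

/-- The elements `2 + k, ..., t + 1` have been pushed onto the rightmost stack. -/
def Loading (t : ℕ) (c : Conf) : Prop :=
  ∃ k m, k + m = t ∧
    c = ⟨(List.range' 2 k).reverse ++ [t + 2, 1],
      stacksOf t (Function.update (fun _ => []) (t - 1) (List.range' (2 + k) m)), []⟩

lemma Blocked.applyMove {t m : ℕ} {c : Conf} (ht : 0 < t) (h : Blocked t c) (hm : m ≤ t)
    (hl : legal t c m = true) : Blocked t (applyMove t c m) := by
  obtain ⟨f, rfl, hmem, hbd, hord, hsort⟩ := h
  rcases Nat.eq_zero_or_pos m with rfl | hm0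
  · obtain ⟨s, hs⟩ := (legal_zero_iff ht).1 hl
    have := hbd 0 1 (by simp [hs])
    omega
  rcases hm.lt_or_eq with hmt | rfl
  · obtain ⟨x, s, hs, hx⟩ := (legal_middle_iff hm0 hmt).1 hl
    rw [applyMove_middle hm0 hmt hs]
    obtain ⟨n, rfl⟩ : ∃ n, m = n + 1 := ⟨m - 1, by omega⟩
    simp only [Nat.add_sub_cancel] at hx ⊢
    have hn : f n = [] := by
      cases hfn : f n with
      | nil => rfl
      | cons y l =>
        have := hord n (n + 1) (by omega) y (by simp [hfn]) x (by simp [hs])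
        simp only [hfn, canPush, decide_eq_true_eq] at hx
        omega
    have hsx := hsort (n + 1)
    rw [hs, List.pairwise_cons] at hsx
    have hxb := hbd (n + 1) x (by simp [hs])
    have hxn : x ≤ n + 2 := by
      by_contra hlt
      obtain ⟨i, hi, hxi⟩ := hmem (x - 1) (by omega) (by omega)
      have := hbd i _ hxi
      rcases lt_trichotomy i (n + 1) with h | rfl | h
      · obtain rfl : i = n := by omega
        simp [hn] at hxi
      · rw [hs, List.mem_cons] at hxi
        rcases hxi with h | h
        · omega
        · have := hsx.1 _ h
          omega
      · have := hord (n + 1) i h x (by simp [hs]) _ hxi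
        omega
    set g := Function.update (Function.update f (n + 1) s) n (x :: f n) with hg
    have hgn : g n = [x] := by simp [hg, hn]
    have hgs : g (n + 1) = s := by simp [hg]
    have hgo : ∀ i, i ≠ n → i ≠ n + 1 → g i = f i := by
      intro i h₁ h₂
      simp [hg, h₁, h₂]
    clear_value g
    have hxm : x ∈ f (n + 1) := by simp [hs]
    have hsub : ∀ i, ∀ y ∈ g i, (i ≠ n ∧ y ∈ f i) ∨ (i = n ∧ y = x) := by
      intro i y hy
      by_cases hin : i = n
      · subst hin
        simpa [hgn] using hy
      by_cases hin' : i = n + 1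
      · subst hin'
        rw [hgs] at hy
        simp [hs, hy]
      · rw [hgo i hin hin'] at hy
        exact .inl ⟨hin, hy⟩
    refine ⟨g, rfl, ?_, ?_, ?_, ?_⟩
    · intro y hy hyt
      obtain ⟨i, hi, hyi⟩ := hmem y hy hyt
      by_cases hin : i = n
      · simp [hin, hn] at hyi
      by_cases hin' : i = n + 1
      · rw [hin', hs, List.mem_cons] at hyi
        rcases hyi with rfl | hyi
        · exact ⟨n, by omega, by simp [hgn]⟩
        · exact ⟨n + 1, hmt, by rwa [hgs]⟩
      · exact ⟨i, hi, by rwa [hgo i hin hin']⟩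
    · intro i y hy
      rcases hsub i y hy with ⟨-, h⟩ | ⟨rfl, rfl⟩
      · exact hbd i y h
      · exact ⟨hxb.1, hxn⟩
    · intro i j hij y hy z hz
      rcases hsub i y hy with ⟨_, hyi⟩ | ⟨rfl, rfl⟩ <;>
        rcases hsub j z hz with ⟨_, hzj⟩ | ⟨rfl, rfl⟩
      · exact hord i j hij y hyi z hzj
      · exact hord i (j + 1) (by omega) y hyi z hxm
      · rcases (show i + 1 ≤ j from hij).lt_or_eq with h | rfl
        · exact hord (i + 1) j h y hxm z hzj
        · rw [hgs] at hz
          exact hsx.1 z hz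
      · omega
    · intro i
      by_cases hin : i = n
      · simp [hin, hgn]
      by_cases hin' : i = n + 1
      · simpa [hin', hgs] using hsx.2
      · rw [hgo i hin hin']
        exact hsort i
  · obtain ⟨x, r, hx, hp⟩ := (legal_last_iff ht).1 hl
    obtain ⟨i, hi, hti⟩ := hmem (m + 1) (by omega) le_rfl
    have := hbd i _ hti
    obtain rfl : i = m - 1 := by omega
    cases hf : f (m - 1) with
    | nil => simp [hf] at hti
    | cons y l =>
      have := hbd (m - 1) y (by simp [hf])
      simp only [hf, canPush, decide_eq_true_eq] at hp
      simp only [List.cons.injEq] at hx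
      omega

lemma Loading.greedyStep {t : ℕ} {c : Conf} (ht : 0 < t) (h : Loading t c) :
    Loading t (greedyStep rightMove t c) ∨ Blocked t c := by
  obtain ⟨k, m, hkm, rfl⟩ := h
  cases k with
  | zero =>
    right
    obtain rfl : m = t := by omega
    refine ⟨Function.update (fun _ => []) (m - 1) (List.range' 2 m), by simp, ?_, ?_, ?_, ?_⟩
    · intro x _ _
      exact ⟨m - 1, by omega, by simp; omega⟩
    · intro i x hx
      by_cases hi : i = m - 1
      · subst hi
        simp at hx
        omega
      · simp [hi] at hx
    · intro i j hij x hx y hy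
      by_cases hi : i = m - 1
      · simp [show j ≠ m - 1 by omega] at hy
      · simp [hi] at hx
    · intro i
      by_cases hi : i = m - 1
      · subst hi
        simpa using List.pairwise_lt_range'
      · simp [hi]
  | succ k =>
    left
    refine ⟨k, m + 1, by omega, ?_⟩
    have hinp : (List.range' 2 (k + 1)).reverse ++ [t + 2, 1] =
        (2 + k) :: ((List.range' 2 k).reverse ++ [t + 2, 1]) := by
      simp [List.range'_concat]
    rw [hinp, _root_.greedyStep, rightMove_eq_last]
    · simp only [applyMove_last ht, Function.update_self, Function.update_idem, List.range'_succ,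
        add_assoc]
    · rw [legal_last_iff ht]
      refine ⟨_, _, rfl, ?_⟩
      rw [Function.update_self]
      cases m <;> simp [canPush, List.range'_succ]

lemma Blocked.greedyStep {t : ℕ} {c : Conf} (ht : 0 < t) (h : Blocked t c) :
    Blocked t (greedyStep rightMove t c) := by
  unfold _root_.greedyStep
  split
  · next m hm =>
    obtain ⟨hmt, hl⟩ := rightMove_legal hm
    exact h.applyMove ht hmt hl
  · exact h

lemma not_rightGreedySorts {t : ℕ} (ht : 0 < t) :
    ¬ RightGreedySorts t ((List.range' 2 t).reverse ++ [t + 2, 1]) := by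
  rintro ⟨k, hk⟩
  have hinv : ∀ k, Loading t ((greedyStep rightMove t)^[k]
        (initConf t ((List.range' 2 t).reverse ++ [t + 2, 1]))) ∨
      Blocked t ((greedyStep rightMove t)^[k]
        (initConf t ((List.range' 2 t).reverse ++ [t + 2, 1]))) := by
    intro k
    induction k with
    | zero => exact .inl ⟨t, 0, rfl, by simp [initConf, ← stacksOf_nil]⟩
    | succ k ih =>
      rw [Function.iterate_succ_apply']
      rcases ih with h | h
      · exact (h.greedyStep ht).imp_right (·.greedyStep ht)
      · exact .inr (h.greedyStep ht)
  have := hinv k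
  rw [hk] at this
  rcases this with ⟨_, _, _, h⟩ | ⟨_, h, _⟩ <;> simp [finalConf] at h

/-- For `t > 1`, the permutation `(t+1) t (t-1) ... 3 2 (t+2) 1` is not sortable by the
right-greedy algorithm on `t` stacks, but is sortable by the left-greedy algorithm on
`2` stacks and hence on `t` stacks. -/
theorem stmt5 (t : ℕ) (ht : 1 < t) :
    ¬ RightGreedySorts t ((List.range' 2 t).reverse ++ [t + 2, 1]) ∧
    LeftGreedySorts 2 ((List.range' 2 t).reverse ++ [t + 2, 1]) ∧
    LeftGreedySorts t ((List.range' 2 t).reverse ++ [t + 2, 1]) :=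
  ⟨not_rightGreedySorts (by omega), leftGreedySorts_of_one_lt one_lt_two (by omega),
    leftGreedySorts_of_one_lt ht (by omega)⟩
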